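/- arXiv:1010.4218 — 12 statements merged into one kernel-verified Lean document; each statement's English description precedes it below -/
import Mathlib

section
/- Let Λ = (Λ_j)_{j∈J} be a g-Riesz basis of (H,(H_j)), say Λ_j = θ_j ∘ X for a g-orthonormal basis θ = (θ_j) and a bounded operator X on H with bounded inverse. Let S_Λ be the g-frame operator of Λ and S_Λ⁻¹ its bounded inverse. Then the canonical dual satisfies Λ̃_j = Λ_j ∘ S_Λ⁻¹ = θ_j ∘ (X*)⁻¹ for every j ∈ J; in particular, the canonical dual Λ̃ is itself a g-Riesz basis of (H,(H_j)). -/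
open scoped ComplexInnerProductSpace

noncomputable section

variable {J H : Type*} [NormedAddCommGroup H] [InnerProductSpace ℂ H] [CompleteSpace H]
  {G : J → Type*} [∀ j, NormedAddCommGroup (G j)] [∀ j, InnerProductSpace ℂ (G j)]
  [∀ j, CompleteSpace (G j)]

/-- `Λ` is an `(A,B)` g-frame of `(H, (G j))`. -/
def IsGFrameWith (Λ : ∀ j, H →L[ℂ] G j) (A B : ℝ) : Prop :=
  0 < A ∧ A ≤ B ∧ ∀ f : H,
    Summable (fun j => ‖Λ j f‖ ^ 2) ∧
    A * ‖f‖ ^ 2 ≤ ∑' j, ‖Λ j f‖ ^ 2 ∧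
    ∑' j, ‖Λ j f‖ ^ 2 ≤ B * ‖f‖ ^ 2

/-- `Λ` is a g-frame. -/
def IsGFrame (Λ : ∀ j, H →L[ℂ] G j) : Prop :=
  ∃ A B : ℝ, IsGFrameWith Λ A B

/-- `Λ` is a g-Bessel family with bound `B`. -/
def IsGBessel (Λ : ∀ j, H →L[ℂ] G j) (B : ℝ) : Prop :=
  0 < B ∧ ∀ f : H,
    Summable (fun j => ‖Λ j f‖ ^ 2) ∧ ∑' j, ‖Λ j f‖ ^ 2 ≤ B * ‖f‖ ^ 2

/-- The family `θ` is g-orthonormal. -/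
def GOrthonormal (θ : ∀ j, H →L[ℂ] G j) : Prop :=
  (∀ j k, j ≠ k → ∀ (f : G j) (g : G k),
    ⟪ContinuousLinearMap.adjoint (θ j) f, ContinuousLinearMap.adjoint (θ k) g⟫ = 0) ∧
  ∀ j, ∀ f g : G j,
    ⟪ContinuousLinearMap.adjoint (θ j) f, ContinuousLinearMap.adjoint (θ j) g⟫ = ⟪f, g⟫

/-- The family `θ` is a g-orthonormal basis. -/
def GONBasis (θ : ∀ j, H →L[ℂ] G j) : Prop :=
  GOrthonormal θ ∧ ∀ f : H, HasSum (fun j => ‖θ j f‖ ^ 2) (‖f‖ ^ 2)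

/-- `Λ` is a g-Riesz basis: `Λ j = θ j ∘ X` for a g-orthonormal basis `θ` and a
bounded operator `X` with bounded inverse. -/
def IsGRieszBasis (Λ : ∀ j, H →L[ℂ] G j) : Prop :=
  ∃ (X Xinv : H →L[ℂ] H) (θ : ∀ j, H →L[ℂ] G j),
    X.comp Xinv = ContinuousLinearMap.id ℂ H ∧
    Xinv.comp X = ContinuousLinearMap.id ℂ H ∧
    GONBasis θ ∧ ∀ j, Λ j = (θ j).comp X

/-- `S` is the g-frame operator of `Λ`: `S f = Σ_j Λ_j* (Λ_j f)`. -/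
def IsGFrameOp (Λ : ∀ j, H →L[ℂ] G j) (S : H →L[ℂ] H) : Prop :=
  ∀ f : H, HasSum (fun j => ContinuousLinearMap.adjoint (Λ j) (Λ j f)) (S f)

/-- `Γ` is a dual g-frame of `Λ`: it is a g-frame and `f = Σ_j Γ_j* (Λ_j f)`. -/
def IsDualGFrame (Λ Γ : ∀ j, H →L[ℂ] G j) : Prop :=
  IsGFrame Γ ∧ ∀ f : H, HasSum (fun j => ContinuousLinearMap.adjoint (Γ j) (Λ j f)) f


/-- Each member of a g-orthonormal family satisfies `θ k ∘ (θ k)* = 1`. -/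
theorem GOrthonormal.apply_adjoint_self {θ : ∀ j, H →L[ℂ] G j} (hθ : GOrthonormal θ)
    (k : J) (f : G k) : θ k (ContinuousLinearMap.adjoint (θ k) f) = f := by
  refine ext_inner_left ℂ fun v => ?_
  rw [← ContinuousLinearMap.adjoint_inner_left]
  exact hθ.2 k v f

/-- Distinct members of a g-orthonormal family satisfy `θ k ∘ (θ j)* = 0`. -/
theorem GOrthonormal.apply_adjoint_of_ne {θ : ∀ j, H →L[ℂ] G j} (hθ : GOrthonormal θ)
    {j k : J} (h : j ≠ k) (f : G j) : θ k (ContinuousLinearMap.adjoint (θ j) f) = 0 := by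
  refine ext_inner_left ℂ fun v => ?_
  rw [← ContinuousLinearMap.adjoint_inner_left, inner_zero_right]
  exact hθ.1 k j h.symm v f

/-- Adjoints of mutually inverse operators are mutually inverse. -/
theorem adjoint_comp_adjoint_eq_id {A B : H →L[ℂ] H}
    (h : B.comp A = ContinuousLinearMap.id ℂ H) :
    (ContinuousLinearMap.adjoint A).comp (ContinuousLinearMap.adjoint B) =
      ContinuousLinearMap.id ℂ H := by
  rw [← ContinuousLinearMap.adjoint_comp, h, ContinuousLinearMap.adjoint_id]

/-- If `Λ j = θ j ∘ X` with `θ` g-orthonormal and `S` the g-frame operator of `Λ`, then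
`θ k ∘ (X⁻¹)* ∘ S = Λ k`. -/
theorem GOrthonormal.comp_adjoint_comp_gFrameOp {θ Λ : ∀ j, H →L[ℂ] G j}
    (hθ : GOrthonormal θ) {X Xinv S : H →L[ℂ] H}
    (hX : X.comp Xinv = ContinuousLinearMap.id ℂ H)
    (hΛ : ∀ j, Λ j = (θ j).comp X) (hS : IsGFrameOp Λ S) (k : J) (f : H) :
    θ k (ContinuousLinearMap.adjoint Xinv (S f)) = Λ k f := by
  have key (j : J) : ContinuousLinearMap.adjoint Xinv
      (ContinuousLinearMap.adjoint (Λ j) (Λ j f)) =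
        ContinuousLinearMap.adjoint (θ j) (Λ j f) := by
    have h := DFunLike.congr_fun (adjoint_comp_adjoint_eq_id hX)
      (ContinuousLinearMap.adjoint (θ j) (Λ j f))
    have h' : ContinuousLinearMap.adjoint (Λ j) =
        (ContinuousLinearMap.adjoint X).comp (ContinuousLinearMap.adjoint (θ j)) := by
      rw [hΛ j, ContinuousLinearMap.adjoint_comp]
    rw [h']
    exact h
  have hsum := (hS f).mapL ((θ k).comp (ContinuousLinearMap.adjoint Xinv))
  simp only [ContinuousLinearMap.comp_apply, key] at hsum
  refine hsum.unique ?_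
  have hsingle := hasSum_single (f := fun j => θ k (ContinuousLinearMap.adjoint (θ j) (Λ j f))) k
    fun j hj => hθ.apply_adjoint_of_ne hj _
  simpa only [hθ.apply_adjoint_self] using hsingle

/-- For a g-Riesz basis `Λ_j = θ_j ∘ X`, the canonical dual satisfies
`Λ̃_j = Λ_j ∘ S_Λ⁻¹ = θ_j ∘ (X*)⁻¹`, and `Λ̃` is itself a g-Riesz basis. -/
theorem stmt_0 (θ : ∀ j, H →L[ℂ] G j) (hθ : GONBasis θ)
    (X Xinv : H →L[ℂ] H)
    (hX1 : X.comp Xinv = ContinuousLinearMap.id ℂ H)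
    (hX2 : Xinv.comp X = ContinuousLinearMap.id ℂ H)
    (Λ : ∀ j, H →L[ℂ] G j) (hΛ : ∀ j, Λ j = (θ j).comp X)
    (S Sinv : H →L[ℂ] H) (hS : IsGFrameOp Λ S)
    (hS1 : S.comp Sinv = ContinuousLinearMap.id ℂ H)
    (hS2 : Sinv.comp S = ContinuousLinearMap.id ℂ H) :
    (∀ j, (Λ j).comp Sinv = (θ j).comp (ContinuousLinearMap.adjoint Xinv)) ∧
    IsGRieszBasis (fun j => (Λ j).comp Sinv) := by
  have hdual (j : J) :
      (Λ j).comp Sinv = (θ j).comp (ContinuousLinearMap.adjoint Xinv) := by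
    ext f
    have h := hθ.1.comp_adjoint_comp_gFrameOp hX1 hΛ hS j (Sinv f)
    have hf : S (Sinv f) = f := DFunLike.congr_fun hS1 f
    rw [hf] at h
    exact h.symm
  exact ⟨hdual, ContinuousLinearMap.adjoint Xinv, ContinuousLinearMap.adjoint X, θ,
    adjoint_comp_adjoint_eq_id hX1, adjoint_comp_adjoint_eq_id hX2, hθ, hdual⟩

end
end

section
/- Let Λ = (Λ_j)_{j∈J} be a g-Riesz basis of (H,(H_j)) with g-frame operator S_Λ, and let R be a self-adjoint bounded operator on H with R ∘ S_Λ ∘ R = id_H (i.e. R = S_Λ^{-1/2}). Then the family E = (E_j) with E_j = Λ_j ∘ R is a g-orthonormal basis of (H,(H_j)): ⟨E_j* f, E_k* g⟩_H = 0 for j ≠ k (f ∈ H_j, g ∈ H_k), ⟨E_j* f, E_j* g⟩_H = ⟨f, g⟩_{H_j} for all f, g ∈ H_j, and Σ_j ‖E_j f‖² = ‖f‖² for all f ∈ H. -/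
open scoped ComplexInnerProductSpace

noncomputable section

variable {J H : Type*} [NormedAddCommGroup H] [InnerProductSpace ℂ H] [CompleteSpace H]
  {G : J → Type*} [∀ j, NormedAddCommGroup (G j)] [∀ j, InnerProductSpace ℂ (G j)]
  [∀ j, CompleteSpace (G j)]

theorem GOrthonormal.comp {θ : ∀ j, H →L[ℂ] G j} (hθ : GOrthonormal θ) {U : H →L[ℂ] H}
    (hU : U.comp (ContinuousLinearMap.adjoint U) = ContinuousLinearMap.id ℂ H) :
    GOrthonormal (fun j => (θ j).comp U) := by
  have key : ∀ a b : H, ⟪ContinuousLinearMap.adjoint U a, ContinuousLinearMap.adjoint U b⟫ =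
      ⟪a, b⟫ := fun a b => by
    rw [ContinuousLinearMap.adjoint_inner_left, ← ContinuousLinearMap.comp_apply, hU,
      ContinuousLinearMap.id_apply]
  constructor
  · intro j k hjk f g
    simp only [ContinuousLinearMap.adjoint_comp, ContinuousLinearMap.comp_apply, key]
    exact hθ.1 j k hjk f g
  · intro j f g
    simp only [ContinuousLinearMap.adjoint_comp, ContinuousLinearMap.comp_apply, key]
    exact hθ.2 j f g

theorem GONBasis.comp {θ : ∀ j, H →L[ℂ] G j} (hθ : GONBasis θ) {U : H →L[ℂ] H}
    (hU : ∀ f, ‖U f‖ = ‖f‖) (hsurj : Function.Surjective U) :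
    GONBasis (fun j => (θ j).comp U) := by
  refine ⟨hθ.1.comp ?_, fun f => by simpa [hU f] using hθ.2 (U f)⟩
  have hadj := (ContinuousLinearMap.norm_map_iff_adjoint_comp_self U).1 hU
  ext y
  obtain ⟨x, rfl⟩ := hsurj y
  exact congrArg U (DFunLike.congr_fun hadj x)

theorem IsGFrameOp.hasSum_norm_sq {Λ : ∀ j, H →L[ℂ] G j} {S : H →L[ℂ] H}
    (hS : IsGFrameOp Λ S) (f : H) :
    HasSum (fun j => ((‖Λ j f‖ ^ 2 : ℝ) : ℂ)) ⟪f, S f⟫ := by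
  have h := (innerSL ℂ f).hasSum (hS f)
  simpa [Function.comp_def, ContinuousLinearMap.adjoint_inner_right,
    inner_self_eq_norm_sq_to_K] using h

/-- If `Λ` is a g-Riesz basis and `R = S_Λ^{-1/2}` (a self-adjoint bounded
operator with `R S_Λ R = id`), then `E_j = Λ_j ∘ R` is a g-orthonormal basis. -/
theorem stmt_2 (Λ : ∀ j, H →L[ℂ] G j) (hΛ : IsGRieszBasis Λ)
    (S : H →L[ℂ] H) (hS : IsGFrameOp Λ S)
    (R : H →L[ℂ] H) (hR : ContinuousLinearMap.adjoint R = R)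
    (hRSR : R.comp (S.comp R) = ContinuousLinearMap.id ℂ H) :
    GONBasis (fun j => (Λ j).comp R) := by
  obtain ⟨X, Xinv, θ, hX, -, hθ, hΛθ⟩ := hΛ
  obtain rfl : Λ = fun j => (θ j).comp X := funext hΛθ
  refine hθ.comp (U := X.comp R) (fun f => ?_) ?_
  · have hsum := hS.hasSum_norm_sq (R f)
    have hnorm := Complex.hasSum_ofReal.2 (hθ.2 (X (R f)))
    have hinner : ⟪R f, S (R f)⟫ = ⟪f, f⟫ := by
      rw [← ContinuousLinearMap.adjoint_inner_right, hR]
      exact congrArg _ (DFunLike.congr_fun hRSR f)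
    rw [hinner, inner_self_eq_norm_sq_to_K] at hsum
    have hsq : ‖X (R f)‖ ^ 2 = ‖f‖ ^ 2 :=
      Complex.ofReal_injective (by simpa using hnorm.unique hsum)
    exact (sq_eq_sq₀ (norm_nonneg _) (norm_nonneg _)).1 hsq
  · have hXsurj : Function.Surjective X := fun y => ⟨Xinv y, DFunLike.congr_fun hX y⟩
    have hRsurj : Function.Surjective R := fun y => ⟨S (R y), DFunLike.congr_fun hRSR y⟩
    exact hXsurj.comp hRsurj

end
end

section
/- Let Λ = (Λ_j)_{j∈J} and Θ = (θ_j)_{j∈J} be g-Bessel families of (H,(H_j)) such that f = Σ_{j∈J} Λ_j*(θ_j f) for every f ∈ H (series converging in H). Then both Λ and Θ are g-frames, i.e. each also admits a positive lower g-frame bound. -/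
open scoped ComplexInnerProductSpace

noncomputable section

variable {J H : Type*} [NormedAddCommGroup H] [InnerProductSpace ℂ H] [CompleteSpace H]
  {G : J → Type*} [∀ j, NormedAddCommGroup (G j)] [∀ j, InnerProductSpace ℂ (G j)]
  [∀ j, CompleteSpace (G j)]

/-- If the pairing of two g-Bessel families reproduces the squared norm, then the first one is
a g-frame. -/
theorem isGFrame_of_hasSum_re_inner {Λ Θ : ∀ j, H →L[ℂ] G j} {B₁ B₂ : ℝ}
    (hΛ : IsGBessel Λ B₁) (hΘ : IsGBessel Θ B₂)
    (h : ∀ f : H, HasSum (fun j => (inner ℂ (Λ j f) (Θ j f)).re) (‖f‖ ^ 2)) :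
    IsGFrame Λ := by
  have hB₂ := hΘ.1
  refine ⟨B₂⁻¹, max B₁ B₂⁻¹, inv_pos.2 hB₂, le_max_right _ _, fun f => ?_⟩
  obtain ⟨hsΛ, hbΛ⟩ := hΛ.2 f
  obtain ⟨hsΘ, hbΘ⟩ := hΘ.2 f
  refine ⟨hsΛ, ?_, hbΛ.trans (by gcongr; exact le_max_left _ _)⟩
  have hterm (j : J) : (inner ℂ (Λ j f) (Θ j f)).re ≤
      B₂ / 2 * ‖Λ j f‖ ^ 2 + (2 * B₂)⁻¹ * ‖Θ j f‖ ^ 2 := by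
    refine (re_inner_le_norm (𝕜 := ℂ) (Λ j f) (Θ j f)).trans ?_
    have hsq : B₂ / 2 * ‖Λ j f‖ ^ 2 + (2 * B₂)⁻¹ * ‖Θ j f‖ ^ 2 - ‖Λ j f‖ * ‖Θ j f‖ =
        (2 * B₂)⁻¹ * (B₂ * ‖Λ j f‖ - ‖Θ j f‖) ^ 2 := by
      field_simp
      ring
    have : 0 ≤ (2 * B₂)⁻¹ * (B₂ * ‖Λ j f‖ - ‖Θ j f‖) ^ 2 := by positivity
    linarith
  have hle := hasSum_le hterm (h f)
    ((hsΛ.hasSum.mul_left (B₂ / 2)).add (hsΘ.hasSum.mul_left (2 * B₂)⁻¹))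
  have hhalf : (2 * B₂)⁻¹ * ∑' j, ‖Θ j f‖ ^ 2 ≤ ‖f‖ ^ 2 / 2 := by
    calc _ ≤ (2 * B₂)⁻¹ * (B₂ * ‖f‖ ^ 2) := by gcongr
      _ = ‖f‖ ^ 2 / 2 := by field_simp
  rw [inv_mul_le_iff₀ hB₂]
  linarith

/-- Two g-Bessel families satisfying the reconstruction formula
`f = Σ_j Λ_j*(θ_j f)` are both g-frames. -/
theorem stmt_3 (Λ Θ : ∀ j, H →L[ℂ] G j) (B₁ B₂ : ℝ)
    (hΛ : IsGBessel Λ B₁) (hΘ : IsGBessel Θ B₂)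
    (hrec : ∀ f : H, HasSum (fun j => ContinuousLinearMap.adjoint (Λ j) (Θ j f)) f) :
    IsGFrame Λ ∧ IsGFrame Θ := by
  have h (f : H) : HasSum (fun j => (inner ℂ (Λ j f) (Θ j f)).re) (‖f‖ ^ 2) := by
    have := Complex.reCLM.hasSum ((innerSL ℂ f).hasSum (hrec f))
    simpa [Function.comp_def, ContinuousLinearMap.adjoint_inner_right,
      inner_self_eq_norm_sq_to_K, ← Complex.ofReal_pow] using this
  refine ⟨isGFrame_of_hasSum_re_inner hΛ hΘ h, isGFrame_of_hasSum_re_inner hΘ hΛ fun f => ?_⟩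
  simpa only [← RCLike.re_eq_complex_re, inner_re_symm] using h f

end
end

section
/- Let Λ = (Λ_i)_{i∈J} be a g-frame of (H,(H_i)) and Θ = (θ_i) an alternate dual g-frame of Λ, i.e. a g-frame with f = Σ_i θ_i*(Λ_i f) for all f ∈ H. For each i let (e_{i,k})_{k∈K_i} be an orthonormal basis of H_i, and set u_{i,k} = Λ_i* e_{i,k} and v_{i,k} = θ_i* e_{i,k}. Then (v_{i,k})_{i∈J, k∈K_i} is a dual frame of (u_{i,k})_{i∈J, k∈K_i}: both families are frames of H and for every f ∈ H one has f = Σ_{i∈J} Σ_{k∈K_i} ⟨f, u_{i,k}⟩ v_{i,k} (inner product linear in the first argument, series converging in H). -/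
open scoped ComplexInnerProductSpace

noncomputable section

variable {J H : Type*} [NormedAddCommGroup H] [InnerProductSpace ℂ H] [CompleteSpace H]
  {G : J → Type*} [∀ j, NormedAddCommGroup (G j)] [∀ j, InnerProductSpace ℂ (G j)]
  [∀ j, CompleteSpace (G j)]

/-- A family of vectors `u : ι → H` is a frame of `H`. -/
def IsVectorFrame {ι : Type*} (u : ι → H) : Prop :=
  ∃ A B : ℝ, 0 < A ∧ A ≤ B ∧ ∀ f : H,
    Summable (fun α => ‖(⟪u α, f⟫ : ℂ)‖ ^ 2) ∧
    A * ‖f‖ ^ 2 ≤ ∑' α, ‖(⟪u α, f⟫ : ℂ)‖ ^ 2 ∧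
    ∑' α, ‖(⟪u α, f⟫ : ℂ)‖ ^ 2 ≤ B * ‖f‖ ^ 2

/-- Parseval's identity for a Hilbert basis. -/
theorem HilbertBasis.hasSum_norm_inner_sq {ι E : Type*} [NormedAddCommGroup E]
    [InnerProductSpace ℂ E] (b : HilbertBasis ι ℂ E) (x : E) :
    HasSum (fun i => ‖(⟪b i, x⟫ : ℂ)‖ ^ 2) (‖x‖ ^ 2) := by
  have h := (b.hasSum_inner_mul_inner x x).mapL Complex.reCLM
  convert! h using 1
  · ext i
    rw [← inner_conj_symm x (b i), mul_comm, Complex.mul_conj, Complex.normSq_eq_norm_sq]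
    exact (Complex.ofReal_re _).symm
  · rw [inner_self_eq_norm_sq_to_K]
    norm_cast

/-- The vectors `Λ_i* e_{i,k}` induced by a g-frame `Λ` and Hilbert bases `e_i` form a frame. -/
theorem IsGFrame.isVectorFrame_adjoint_hilbertBasis {K : J → Type*} {Λ : ∀ i, H →L[ℂ] G i}
    (hΛ : IsGFrame Λ) (e : ∀ i, HilbertBasis (K i) ℂ (G i)) :
    IsVectorFrame
      (fun p : Σ i, K i => ContinuousLinearMap.adjoint (Λ p.1) (e p.1 p.2)) := by
  obtain ⟨A, B, hA, hAB, h⟩ := hΛ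
  refine ⟨A, B, hA, hAB, fun f => ?_⟩
  obtain ⟨hs, hl, hu⟩ := h f
  simp only [ContinuousLinearMap.adjoint_inner_left]
  have hfib := fun i => (e i).hasSum_norm_inner_sq (Λ i f)
  have hsum : Summable fun p : Σ i, K i => ‖(⟪e p.1 p.2, Λ p.1 f⟫ : ℂ)‖ ^ 2 := by
    rw [summable_sigma_of_nonneg fun _ => by positivity]
    refine ⟨fun i => (hfib i).summable, ?_⟩
    simpa only [(hfib _).tsum_eq] using hs
  have heq := (hsum.hasSum.sigma hfib).tsum_eq
  rw [← heq]
  exact ⟨hsum, hl, hu⟩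

/-- Square-summable coefficients give an unconditionally convergent series against a family
satisfying an upper frame bound. -/
theorem IsVectorFrame.summable_smul {ι : Type*} {v : ι → H} (hv : IsVectorFrame v) {c : ι → ℂ}
    (hc : Summable fun α => ‖c α‖ ^ 2) : Summable fun α => c α • v α := by
  obtain ⟨A, B, hA, hAB, h⟩ := hv
  have hB : 0 < B := hA.trans_le hAB
  have key (s : Finset ι) : ‖∑ α ∈ s, c α • v α‖ ^ 2 ≤ B * ∑ α ∈ s, ‖c α‖ ^ 2 := by
    set x := ∑ α ∈ s, c α • v α with hx
    obtain ⟨hs, -, hu⟩ := h x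
    have hbound : ∑ α ∈ s, ‖(⟪v α, x⟫ : ℂ)‖ ^ 2 ≤ B * ‖x‖ ^ 2 :=
      (hs.sum_le_tsum s fun _ _ => by positivity).trans hu
    have hle : ‖x‖ ^ 2 ≤ ∑ α ∈ s, ‖c α‖ * ‖(⟪v α, x⟫ : ℂ)‖ := by
      calc ‖x‖ ^ 2 = ‖(⟪x, x⟫ : ℂ)‖ := by simp [inner_self_eq_norm_sq_to_K]
        _ = ‖∑ α ∈ s, (⟪c α • v α, x⟫ : ℂ)‖ := by rw [← sum_inner, ← hx]
        _ ≤ ∑ α ∈ s, ‖(⟪c α • v α, x⟫ : ℂ)‖ := norm_sum_le _ _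
        _ = _ := by simp [mul_comm]
    have hcs := Finset.sum_mul_sq_le_sq_mul_sq s (fun α => ‖c α‖) fun α => ‖(⟪v α, x⟫ : ℂ)‖
    have hc0 : 0 ≤ ∑ α ∈ s, ‖c α‖ ^ 2 := by positivity
    have hsq : ‖x‖ ^ 2 * ‖x‖ ^ 2 ≤ (B * ∑ α ∈ s, ‖c α‖ ^ 2) * ‖x‖ ^ 2 := by
      calc ‖x‖ ^ 2 * ‖x‖ ^ 2 = (‖x‖ ^ 2) ^ 2 := by ring
        _ ≤ (∑ α ∈ s, ‖c α‖ * ‖(⟪v α, x⟫ : ℂ)‖) ^ 2 := by gcongr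
        _ ≤ (∑ α ∈ s, ‖c α‖ ^ 2) * ∑ α ∈ s, ‖(⟪v α, x⟫ : ℂ)‖ ^ 2 := hcs
        _ ≤ (∑ α ∈ s, ‖c α‖ ^ 2) * (B * ‖x‖ ^ 2) := by gcongr
        _ = _ := by ring
    rcases (sq_nonneg ‖x‖).eq_or_lt with h0 | h0
    · rw [← h0]; positivity
    · exact le_of_mul_le_mul_right hsq h0
  rw [summable_iff_vanishing_norm] at hc ⊢
  intro ε hε
  obtain ⟨s, hs⟩ := hc (ε ^ 2 / B) (by positivity)
  refine ⟨s, fun t ht => ?_⟩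
  have ht' := (le_abs_self _).trans_lt (hs t ht)
  rw [lt_div_iff₀ hB, mul_comm] at ht'
  exact lt_of_pow_lt_pow_left₀ 2 hε.le ((key t).trans_lt ht')

/-- If `Θ` is an alternate dual g-frame of `Λ` and `(e_{i,k})_k` is an
Hilbert (orthonormal) basis of `H_i`, then `v_{i,k} = θ_i* e_{i,k}` is a dual frame of
`u_{i,k} = Λ_i* e_{i,k}`. -/
theorem stmt_4 {K : J → Type*} (Λ Θ : ∀ i, H →L[ℂ] G i)
    (hΛ : IsGFrame Λ) (hΘ : IsGFrame Θ)
    (hdual : ∀ f : H, HasSum (fun i => ContinuousLinearMap.adjoint (Θ i) (Λ i f)) f)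
    (e : ∀ i, HilbertBasis (K i) ℂ (G i))
    (u v : ∀ i, K i → H)
    (hu : ∀ i k, u i k = ContinuousLinearMap.adjoint (Λ i) (e i k))
    (hv : ∀ i k, v i k = ContinuousLinearMap.adjoint (Θ i) (e i k)) :
    IsVectorFrame (fun p : Σ i, K i => u p.1 p.2) ∧
    IsVectorFrame (fun p : Σ i, K i => v p.1 p.2) ∧
    ∀ f : H, HasSum (fun p : Σ i, K i => (⟪u p.1 p.2, f⟫ : ℂ) • v p.1 p.2) f := by
  obtain rfl : u = fun i k => ContinuousLinearMap.adjoint (Λ i) (e i k) :=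
    funext₂ hu
  obtain rfl : v = fun i k => ContinuousLinearMap.adjoint (Θ i) (e i k) :=
    funext₂ hv
  have hU := hΛ.isVectorFrame_adjoint_hilbertBasis e
  have hV := hΘ.isVectorFrame_adjoint_hilbertBasis e
  refine ⟨hU, hV, fun f => ?_⟩
  obtain ⟨_, _, _, _, hbound⟩ := hU
  have hsum := (hV.summable_smul (hbound f).1).hasSum
  have hfib (i : J) := ((e i).hasSum_repr (Λ i f)).mapL (ContinuousLinearMap.adjoint (Θ i))
  simp only [map_smul, HilbertBasis.repr_apply_apply,
    ← ContinuousLinearMap.adjoint_inner_left] at hfib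
  have heq := (hsum.sigma hfib).unique (hdual f)
  rwa [heq] at hsum

end
end

section
/- Let Λ = (Λ_j)_{j∈J} and Θ = (θ_j)_{j∈J} be g-frames of (H,(H_j)) with analysis operators T_Λ and T_Θ. Then Λ and Θ are similar, i.e. there exists a bounded invertible operator U on H (with bounded inverse) such that Λ_j = θ_j ∘ U for all j ∈ J, if and only if T_Λ and T_Θ have the same range in Ĥ. -/
open scoped ComplexInnerProductSpace

noncomputable section

variable {J H : Type*} [NormedAddCommGroup H] [InnerProductSpace ℂ H] [CompleteSpace H]
  {G : J → Type*} [∀ j, NormedAddCommGroup (G j)] [∀ j, InnerProductSpace ℂ (G j)]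
  [∀ j, CompleteSpace (G j)]

omit [CompleteSpace H] [∀ j, CompleteSpace (G j)] in
theorem IsGFrame.injective_of_apply_eq {Λ : ∀ j, H →L[ℂ] G j} (hΛ : IsGFrame Λ)
    {T : H →L[ℂ] lp G 2} (hT : ∀ (f : H) (j : J), (T f : ∀ j, G j) j = Λ j f) :
    Function.Injective T := by
  rw [injective_iff_map_eq_zero]
  intro f hf
  obtain ⟨A, B, hA, -, h⟩ := hΛ
  have hz : ∀ j, Λ j f = 0 := fun j => by rw [← hT, hf]; rfl
  have h1 := (h f).2.1
  simp only [hz, norm_zero, ne_eq, OfNat.ofNat_ne_zero, not_false_eq_true, zero_pow,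
    tsum_zero] at h1
  have h2 : ‖f‖ ^ 2 ≤ 0 := nonpos_of_mul_nonpos_right h1 hA
  exact norm_eq_zero.mp (pow_eq_zero_iff two_ne_zero |>.mp (le_antisymm h2 (sq_nonneg _)))

/-- Douglas-type factorization through an injective operator, by the closed graph theorem. -/
theorem ContinuousLinearMap.exists_comp_eq_of_range_subset {E E' F : Type*}
    [NormedAddCommGroup E] [NormedSpace ℂ E] [CompleteSpace E]
    [NormedAddCommGroup E'] [NormedSpace ℂ E'] [CompleteSpace E']
    [NormedAddCommGroup F] [NormedSpace ℂ F]
    (S : E' →L[ℂ] F) (T : E →L[ℂ] F) (hS : Function.Injective S)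
    (h : Set.range T ⊆ Set.range S) : ∃ U : E →L[ℂ] E', S.comp U = T := by
  choose u hu using fun x => h (Set.mem_range_self x)
  let L : E →ₗ[ℂ] E' :=
    { toFun := u
      map_add' := fun x y => hS (by simp only [map_add, hu])
      map_smul' := fun c x => hS (by simp only [map_smul, hu, RingHom.id_apply]) }
  refine ⟨ContinuousLinearMap.ofSeqClosedGraph (g := L) ?_, ContinuousLinearMap.ext hu⟩
  intro v x y hv hy
  apply hS
  have h1 : Filter.Tendsto (fun n => S (L (v n))) Filter.atTop (nhds (S y)) :=
    (S.continuous.tendsto y).comp hy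
  have h2 : Filter.Tendsto (fun n => S (L (v n))) Filter.atTop (nhds (T x)) :=
    ((T.continuous.tendsto x).comp hv).congr fun n => (hu (v n)).symm
  exact (tendsto_nhds_unique h1 h2).trans (hu x).symm

/-- Two g-frames are similar iff their analysis operators have the same
range in `Ĥ = ⊕_{ℓ²} H_j`. -/
theorem stmt_5 (Λ Θ : ∀ j, H →L[ℂ] G j) (hΛ : IsGFrame Λ) (hΘ : IsGFrame Θ)
    (TΛ TΘ : H →L[ℂ] lp G 2)
    (hTΛ : ∀ (f : H) (j : J), (TΛ f : ∀ j, G j) j = Λ j f)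
    (hTΘ : ∀ (f : H) (j : J), (TΘ f : ∀ j, G j) j = Θ j f) :
    (∃ U Uinv : H →L[ℂ] H,
      U.comp Uinv = ContinuousLinearMap.id ℂ H ∧
      Uinv.comp U = ContinuousLinearMap.id ℂ H ∧
      ∀ j, Λ j = (Θ j).comp U) ↔
    Set.range TΛ = Set.range TΘ := by
  have injΛ := hΛ.injective_of_apply_eq hTΛ
  have injΘ := hΘ.injective_of_apply_eq hTΘ
  constructor
  · rintro ⟨U, V, hUV, -, h⟩
    have hT : ∀ f, TΛ f = TΘ (U f) := fun f => lp.ext (funext fun j => by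
      rw [hTΛ, hTΘ, h, ContinuousLinearMap.comp_apply])
    have hU : Function.Surjective U := fun f => ⟨V f, DFunLike.congr_fun hUV f⟩
    rw [show ⇑TΛ = TΘ ∘ U from funext hT, hU.range_comp]
  · intro h
    obtain ⟨U, hU⟩ := TΘ.exists_comp_eq_of_range_subset TΛ injΘ h.le
    obtain ⟨V, hV⟩ := TΛ.exists_comp_eq_of_range_subset TΘ injΛ h.ge
    have hU' : ∀ f, TΘ (U f) = TΛ f := DFunLike.congr_fun hU
    have hV' : ∀ f, TΛ (V f) = TΘ f := DFunLike.congr_fun hV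
    refine ⟨U, V, ?_, ?_, fun j => ?_⟩
    · ext f
      exact injΘ ((hU' (V f)).trans (hV' f))
    · ext f
      exact injΛ ((hV' (U f)).trans (hU' f))
    · ext f
      rw [ContinuousLinearMap.comp_apply, ← hTΛ, ← hTΘ, hU']

end
end

section
/- Let Λ = (Λ_j)_{j∈J} be a g-frame of (H,(H_j)) with canonical dual Λ̃_j = Λ_j ∘ S_Λ⁻¹, and let Θ = (θ_j) be a dual g-frame of Λ. Then Θ is the canonical dual of Λ (θ_j = Λ_j ∘ S_Λ⁻¹ for all j) if and only if for every dual g-frame Γ = (Γ_j) of Λ and every f ∈ H one has Σ_j ‖θ_j f‖² ≤ Σ_j ‖Γ_j f‖². -/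
open scoped ComplexInnerProductSpace

noncomputable section

variable {J H : Type*} [NormedAddCommGroup H] [InnerProductSpace ℂ H] [CompleteSpace H]
  {G : J → Type*} [∀ j, NormedAddCommGroup (G j)] [∀ j, InnerProductSpace ℂ (G j)]
  [∀ j, CompleteSpace (G j)]

open ContinuousLinearMap in
/-- The g-frame operator is self-adjoint. -/
lemma IsGFrameOp.adjoint_eq {Λ : ∀ j, H →L[ℂ] G j} {S : H →L[ℂ] H} (hS : IsGFrameOp Λ S) :
    adjoint S = S := by
  refine ((eq_adjoint_iff S S).2 fun f g => ?_).symm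
  have h₁ : HasSum (fun j => ⟪Λ j f, Λ j g⟫) ⟪f, S g⟫ := by
    simpa [adjoint_inner_right] using (hS g).mapL (innerSL ℂ f)
  have h₂ : HasSum (fun j => ⟪Λ j g, Λ j f⟫) ⟪g, S f⟫ := by
    simpa [adjoint_inner_right] using (hS f).mapL (innerSL ℂ g)
  have h₃ : HasSum (fun j => ⟪Λ j f, Λ j g⟫) ⟪S f, g⟫ := by
    simpa using h₂.star
  exact h₃.unique h₁

/-- Each dual family is an orthogonal perturbation of the canonical dual. -/
lemma hasSum_norm_sub_canonical_sq {Λ Γ : ∀ j, H →L[ℂ] G j} {S Sinv : H →L[ℂ] H}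
    (hS : IsGFrameOp Λ S) (hS1 : S.comp Sinv = ContinuousLinearMap.id ℂ H)
    (hΓ : IsDualGFrame Λ Γ) (f : H) :
    HasSum (fun j => ‖Γ j f - Λ j (Sinv f)‖ ^ 2)
      (∑' j, ‖Γ j f‖ ^ 2 - ∑' j, ‖Λ j (Sinv f)‖ ^ 2) := by
  obtain ⟨⟨A, B, -, -, hAB⟩, hdual⟩ := hΓ
  have hcross : HasSum (fun j => (⟪Γ j f, Λ j (Sinv f)⟫).re) (⟪f, Sinv f⟫).re := by
    have h : HasSum (fun j => ⟪Γ j f, Λ j (Sinv f)⟫) ⟪f, Sinv f⟫ := by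
      simpa [ContinuousLinearMap.adjoint_inner_right] using
        (hdual (Sinv f)).mapL (innerSL ℂ f)
    exact Complex.hasSum_re h
  have hcanon : HasSum (fun j => ‖Λ j (Sinv f)‖ ^ 2) (⟪f, Sinv f⟫).re := by
    have h : HasSum (fun j => ⟪Λ j (Sinv f), Λ j (Sinv f)⟫) ⟪Sinv f, S (Sinv f)⟫ := by
      simpa only [innerSL_apply_apply, ContinuousLinearMap.adjoint_inner_right] using
        (hS (Sinv f)).mapL (innerSL ℂ (Sinv f))
    have hf : S (Sinv f) = f := DFunLike.congr_fun hS1 f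
    rw [hf] at h
    have hre : (⟪f, Sinv f⟫).re = (⟪Sinv f, f⟫).re := inner_re_symm (𝕜 := ℂ) f (Sinv f)
    rw [hre]
    refine (Complex.hasSum_re h).congr_fun fun j => ?_
    exact norm_sq_eq_re_inner (𝕜 := ℂ) _
  rw [hcanon.tsum_eq]
  have h := ((hAB f).1.hasSum.sub (hcross.mul_left 2)).add hcanon
  rw [show ∀ a b : ℝ, a - b = a - 2 * b + b by intros; ring]
  exact h.congr_fun fun j => norm_sub_sq (𝕜 := ℂ) _ _

/-- The canonical dual is a dual g-frame. -/
lemma isDualGFrame_canonical {Λ : ∀ j, H →L[ℂ] G j} {S Sinv : H →L[ℂ] H} (hΛ : IsGFrame Λ)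
    (hS : IsGFrameOp Λ S) (hS1 : S.comp Sinv = ContinuousLinearMap.id ℂ H) :
    IsDualGFrame Λ (fun j => (Λ j).comp Sinv) := by
  obtain ⟨A, B, hA, hAB, h⟩ := hΛ
  have hB : 0 ≤ B := hA.le.trans hAB
  have hc : 0 < (‖S‖ + 1) ^ 2 := by positivity
  refine ⟨⟨A / (‖S‖ + 1) ^ 2, B * ‖Sinv‖ ^ 2 + A / (‖S‖ + 1) ^ 2, by positivity,
    le_add_of_nonneg_left (by positivity), fun f => ?_⟩, fun f => ?_⟩
  · obtain ⟨hsum, hlow, hup⟩ := h (Sinv f)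
    refine ⟨hsum, le_trans ?_ hlow, hup.trans ?_⟩
    · have hf : ‖f‖ ≤ (‖S‖ + 1) * ‖Sinv f‖ := by
        have hle := S.le_opNorm (Sinv f)
        rw [show S (Sinv f) = f from DFunLike.congr_fun hS1 f] at hle
        linarith [norm_nonneg (Sinv f)]
      have hf2 : ‖f‖ ^ 2 ≤ (‖S‖ + 1) ^ 2 * ‖Sinv f‖ ^ 2 := by
        rw [← mul_pow]
        gcongr
      rw [div_mul_eq_mul_div, div_le_iff₀ hc]
      nlinarith
    · calc B * ‖Sinv f‖ ^ 2 ≤ B * (‖Sinv‖ * ‖f‖) ^ 2 := by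
            gcongr
            exact Sinv.le_opNorm f
        _ = B * ‖Sinv‖ ^ 2 * ‖f‖ ^ 2 := by ring
        _ ≤ (B * ‖Sinv‖ ^ 2 + A / (‖S‖ + 1) ^ 2) * ‖f‖ ^ 2 := by
            gcongr
            exact le_add_of_nonneg_right (by positivity)
  · have hadj : (ContinuousLinearMap.adjoint Sinv).comp S = ContinuousLinearMap.id ℂ H := by
      have h' := congrArg ContinuousLinearMap.adjoint hS1
      rwa [ContinuousLinearMap.adjoint_comp, hS.adjoint_eq, ContinuousLinearMap.adjoint_id] at h'
    have hf : ContinuousLinearMap.adjoint Sinv (S f) = f := DFunLike.congr_fun hadj f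
    have h' := (hS f).mapL (ContinuousLinearMap.adjoint Sinv)
    rw [hf] at h'
    simpa [ContinuousLinearMap.adjoint_comp] using h'

/-- A dual g-frame `Θ` of `Λ` is the canonical dual iff
`Σ_j ‖θ_j f‖² ≤ Σ_j ‖Γ_j f‖²` for every dual g-frame `Γ` of `Λ` and every `f`. -/
theorem stmt_6 (Λ Θ : ∀ j, H →L[ℂ] G j) (hΛ : IsGFrame Λ)
    (S Sinv : H →L[ℂ] H) (hS : IsGFrameOp Λ S)
    (hS1 : S.comp Sinv = ContinuousLinearMap.id ℂ H)
    (hS2 : Sinv.comp S = ContinuousLinearMap.id ℂ H)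
    (hΘ : IsDualGFrame Λ Θ) :
    (∀ j, Θ j = (Λ j).comp Sinv) ↔
    ∀ Γ : ∀ j, H →L[ℂ] G j, IsDualGFrame Λ Γ →
      ∀ f : H, ∑' j, ‖Θ j f‖ ^ 2 ≤ ∑' j, ‖Γ j f‖ ^ 2 := by
  constructor
  · intro hcan Γ hΓ f
    have h := (hasSum_norm_sub_canonical_sq hS hS1 hΓ f).nonneg fun j => sq_nonneg _
    simpa [hcan] using h
  · intro hmin j
    ext f
    have h := hasSum_norm_sub_canonical_sq hS hS1 hΘ f
    have hle := hmin _ (isDualGFrame_canonical hΛ hS hS1) f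
    have hj := le_hasSum h j fun _ _ => sq_nonneg _
    have hzero : ‖Θ j f - Λ j (Sinv f)‖ ^ 2 ≤ 0 := hj.trans (sub_nonpos.2 hle)
    exact sub_eq_zero.1 (norm_eq_zero.1 (pow_eq_zero_iff two_ne_zero |>.1
      (hzero.antisymm (sq_nonneg _))))

end
end

section
/- Let Λ = (Λ_j)_{j∈J} be a g-Riesz basis of (H,(H_j)). If Θ = (θ_j)_{j∈J} is a g-frame of (H,(H_j)) satisfying f = Σ_{j∈J} θ_j*(Λ_j f) for every f ∈ H, then Θ is uniquely determined and equals the canonical dual of Λ: θ_j = Λ_j ∘ S_Λ⁻¹ for every j ∈ J. -/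
open scoped ComplexInnerProductSpace

noncomputable section

variable {J H : Type*} [NormedAddCommGroup H] [InnerProductSpace ℂ H] [CompleteSpace H]
  {G : J → Type*} [∀ j, NormedAddCommGroup (G j)] [∀ j, InnerProductSpace ℂ (G j)]
  [∀ j, CompleteSpace (G j)]

open ContinuousLinearMap in
/-- A g-Riesz basis is biorthogonal to some family of vectors: for each `k` and `g : G k` there is
a vector mapped to `g` by `Λ k` and killed by every other `Λ j`. -/
theorem IsGRieszBasis.exists_apply_eq {Λ : ∀ j, H →L[ℂ] G j} (hΛ : IsGRieszBasis Λ) (k : J)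
    (g : G k) : ∃ f : H, Λ k f = g ∧ ∀ j, j ≠ k → Λ j f = 0 := by
  obtain ⟨X, Xinv, θ, hX, -, ⟨⟨hoff, hdiag⟩, -⟩, hΛθ⟩ := hΛ
  have hXX (v : H) : X (Xinv v) = v := DFunLike.congr_fun hX v
  refine ⟨Xinv (adjoint (θ k) g), ?_, fun j hj => ?_⟩
  · refine ext_inner_right ℂ fun v => ?_
    rw [hΛθ, comp_apply, hXX, ← adjoint_inner_right, hdiag]
  · refine ext_inner_right ℂ fun v => ?_
    rw [hΛθ, comp_apply, hXX, ← adjoint_inner_right, hoff k j hj.symm, inner_zero_left]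

open ContinuousLinearMap in
/-- The g-frame operator is symmetric. -/
theorem IsGFrameOp.inner_apply_left {Λ : ∀ j, H →L[ℂ] G j} {S : H →L[ℂ] H}
    (hS : IsGFrameOp Λ S) (u v : H) : ⟪S u, v⟫ = ⟪u, S v⟫ := by
  have h₁ : HasSum (fun j => ⟪Λ j v, Λ j u⟫) ⟪v, S u⟫ := by
    simpa only [innerSL_apply_apply, adjoint_inner_right] using (hS u).mapL (innerSL ℂ v)
  have h₂ : HasSum (fun j => ⟪Λ j u, Λ j v⟫) ⟪u, S v⟫ := by
    simpa only [innerSL_apply_apply, adjoint_inner_right] using (hS v).mapL (innerSL ℂ u)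
  have h₃ := h₁.star
  simp only [← starRingEnd_apply, inner_conj_symm] at h₃
  exact h₃.unique h₂

open ContinuousLinearMap in
/-- If `f` is killed by every `Λ j` with `j ≠ k`, then a series `∑ j, Γ j* (Λ j f)` reduces to its
`k`-th term. -/
theorem hasSum_adjoint_apply_eq {Λ Γ : ∀ j, H →L[ℂ] G j} {f v : H} {k : J}
    (hf : ∀ j, j ≠ k → Λ j f = 0) (hv : HasSum (fun j => adjoint (Γ j) (Λ j f)) v) :
    v = adjoint (Γ k) (Λ k f) :=
  hv.unique (hasSum_single k fun j hj => by rw [hf j hj, map_zero])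

/-- A g-Riesz basis has a unique dual g-frame, namely its canonical
dual `Λ_j ∘ S_Λ⁻¹`. -/
theorem stmt_7 (Λ : ∀ j, H →L[ℂ] G j) (hΛ : IsGRieszBasis Λ)
    (S Sinv : H →L[ℂ] H) (hS : IsGFrameOp Λ S)
    (hS1 : S.comp Sinv = ContinuousLinearMap.id ℂ H)
    (hS2 : Sinv.comp S = ContinuousLinearMap.id ℂ H)
    (Θ : ∀ j, H →L[ℂ] G j) (hΘ : IsGFrame Θ)
    (hrec : ∀ f : H, HasSum (fun j => ContinuousLinearMap.adjoint (Θ j) (Λ j f)) f) :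
    ∀ j, Θ j = (Λ j).comp Sinv := by
  intro k
  ext h
  refine ext_inner_right ℂ fun g => ?_
  obtain ⟨f, rfl, hf⟩ := hΛ.exists_apply_eq k g
  have hh : S (Sinv h) = h := DFunLike.congr_fun hS1 h
  calc ⟪Θ k h, Λ k f⟫ = ⟪h, f⟫ := by
        rw [← ContinuousLinearMap.adjoint_inner_right, ← hasSum_adjoint_apply_eq hf (hrec f)]
    _ = ⟪Sinv h, S f⟫ := by rw [← hS.inner_apply_left, hh]
    _ = ⟪((Λ k).comp Sinv) h, Λ k f⟫ := by
        rw [hasSum_adjoint_apply_eq hf (hS f), ContinuousLinearMap.adjoint_inner_right,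
          ContinuousLinearMap.comp_apply]

end
end

section
/- Let Λ = (Λ_j)_{j∈J} be a g-frame of (H,(H_j)) with analysis operator T_Λ : H → Ĥ. Then Λ is a g-Riesz basis if and only if T_Λ is surjective, i.e. Range(T_Λ) = Ĥ. -/
open scoped ComplexInnerProductSpace

noncomputable section

variable {J H : Type*} [NormedAddCommGroup H] [InnerProductSpace ℂ H] [CompleteSpace H]
  {G : J → Type*} [∀ j, NormedAddCommGroup (G j)] [∀ j, InnerProductSpace ℂ (G j)]
  [∀ j, CompleteSpace (G j)]

open ContinuousLinearMap in
/-- Polar decomposition of an invertible operator between complex Hilbert spaces. -/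
theorem exists_polar_decomposition {E F : Type*} [NormedAddCommGroup E] [InnerProductSpace ℂ E]
    [CompleteSpace E] [NormedAddCommGroup F] [InnerProductSpace ℂ F] [CompleteSpace F]
    (e : E ≃L[ℂ] F) :
    ∃ (X : E ≃L[ℂ] E) (U : E ≃ₗᵢ[ℂ] F), ∀ f, e f = U (X f) := by
  obtain ⟨T, hT⟩ : ∃ T : E →L[ℂ] F, T = e := ⟨_, rfl⟩
  let S : E →L[ℂ] E := adjoint T ∘L T
  have hSnn : 0 ≤ S := (nonneg_iff_isPositive S).2 (isPositive_adjoint_comp_self T)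
  have hSunit : IsUnit S := by
    have hleft : T ∘L (e.symm : F →L[ℂ] E) = ContinuousLinearMap.id ℂ F := by ext; simp [hT]
    have hright : (e.symm : F →L[ℂ] E) ∘L T = ContinuousLinearMap.id ℂ E := by ext; simp [hT]
    have hl : adjoint (e.symm : F →L[ℂ] E) ∘L adjoint T = ContinuousLinearMap.id ℂ F := by
      rw [← adjoint_comp, hleft, adjoint_id]
    have hr : adjoint T ∘L adjoint (e.symm : F →L[ℂ] E) = ContinuousLinearMap.id ℂ E := by
      rw [← adjoint_comp, hright, adjoint_id]
    refine ⟨⟨S, (e.symm : F →L[ℂ] E) ∘L adjoint (e.symm : F →L[ℂ] E), ?_, ?_⟩, rfl⟩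
    · ext f
      have h1 := DFunLike.congr_fun hleft (adjoint (e.symm : F →L[ℂ] E) f)
      have h2 := DFunLike.congr_fun hr f
      simp only [comp_apply, id_apply] at h1 h2
      change adjoint T (T ((e.symm : F →L[ℂ] E) (adjoint (e.symm : F →L[ℂ] E) f))) = f
      rw [h1, h2]
    · ext f
      have h1 := DFunLike.congr_fun hright f
      have h2 := DFunLike.congr_fun hl (T f)
      simp only [comp_apply, id_apply] at h1 h2
      change (e.symm : F →L[ℂ] E) (adjoint (e.symm : F →L[ℂ] E) (adjoint T (T f))) = f
      rw [h2, h1]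
  have hXunit : IsUnit (CFC.sqrt S) := (CFC.isUnit_sqrt_iff S hSnn).2 hSunit
  have hXsa : adjoint (CFC.sqrt S) = CFC.sqrt S := (CFC.sqrt_nonneg S).isSelfAdjoint
  obtain ⟨u, hu⟩ := hXunit
  let X : E ≃L[ℂ] E := ContinuousLinearEquiv.unitsEquiv ℂ E u
  have hX : ∀ f, X f = CFC.sqrt S f := fun f => by rw [← hu]; rfl
  have hsq : ∀ f, CFC.sqrt S (CFC.sqrt S f) = S f :=
    DFunLike.congr_fun (CFC.sqrt_mul_sqrt_self S hSnn)
  have hnorm : ∀ f, ‖e f‖ = ‖X f‖ := by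
    intro f
    have h : (⟪T f, T f⟫ : ℂ) = ⟪X f, X f⟫ := by
      rw [← adjoint_inner_left, hX, ← adjoint_inner_left, hXsa, hsq]
      rfl
    rw [inner_self_eq_norm_sq_to_K, inner_self_eq_norm_sq_to_K] at h
    have h' : ‖T f‖ ^ 2 = ‖X f‖ ^ 2 := by exact_mod_cast h
    rw [hT] at h'
    exact (sq_eq_sq₀ (norm_nonneg _) (norm_nonneg _)).1 h'
  refine ⟨X, ⟨(X.symm.trans e).toLinearEquiv, fun x => ?_⟩, fun f => ?_⟩
  · simpa using hnorm (X.symm x)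
  · simp

/-- The coordinate operators of a unitary map onto an `ℓ²`-sum form a g-orthonormal basis. -/
theorem gONBasis_of_linearIsometryEquiv (U : H ≃ₗᵢ[ℂ] lp G 2) (θ : ∀ j, H →L[ℂ] G j)
    (hθ : ∀ j f, θ j f = (U f : ∀ j, G j) j) : GONBasis θ := by
  classical
  have hadj : ∀ j (g : G j),
      ContinuousLinearMap.adjoint (θ j) g = U.symm (lp.single 2 j g) := by
    intro j g
    refine ext_inner_right ℂ fun x => ?_
    rw [ContinuousLinearMap.adjoint_inner_left, hθ, ← U.inner_map_map, U.apply_symm_apply,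
      lp.inner_single_left]
  refine ⟨⟨fun j k hjk f g => ?_, fun j f g => ?_⟩, fun f => ?_⟩
  · rw [hadj, hadj, U.symm.inner_map_map, lp.inner_single_left, lp.single_apply_ne _ _ _ hjk,
      inner_zero_right]
  · rw [hadj, hadj, U.symm.inner_map_map, lp.inner_single_left, lp.single_apply_self]
  · have h := lp.hasSum_norm (p := 2) (by simp) (U f)
    simpa [hθ] using h

/-- The analysis operator of a g-orthonormal family is surjective onto the `ℓ²`-sum. -/
theorem GOrthonormal.exists_forall_apply_eq {θ : ∀ j, H →L[ℂ] G j} (hθ : GOrthonormal θ)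
    (a : lp G 2) : ∃ f : H, ∀ j, θ j f = (a : ∀ j, G j) j := by
  classical
  let W : ∀ j, G j →ₗᵢ[ℂ] H := fun j =>
    (ContinuousLinearMap.adjoint (θ j)).toLinearMap.isometryOfInner (hθ.2 j)
  have hW : OrthogonalFamily ℂ G W := fun j k hjk f g => hθ.1 j k hjk f g
  refine ⟨hW.linearIsometry a, fun j => ext_inner_left ℂ fun g => ?_⟩
  have hg : ContinuousLinearMap.adjoint (θ j) g = hW.linearIsometry (lp.single 2 j g) :=
    (hW.linearIsometry_apply_single g).symm
  rw [← ContinuousLinearMap.adjoint_inner_left, hg, LinearIsometry.inner_map_map,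
    lp.inner_single_left]

/-- A g-frame `Λ` is a g-Riesz basis iff its analysis operator
`T_Λ : H → Ĥ` is surjective. -/
theorem stmt_8 (Λ : ∀ j, H →L[ℂ] G j) (hΛ : IsGFrame Λ)
    (TΛ : H →L[ℂ] lp G 2)
    (hTΛ : ∀ (f : H) (j : J), (TΛ f : ∀ j, G j) j = Λ j f) :
    IsGRieszBasis Λ ↔ Function.Surjective TΛ := by
  constructor
  · rintro ⟨X, Xinv, θ, hXX, -, hθ, hΛθ⟩ a
    obtain ⟨f, hf⟩ := hθ.1.exists_forall_apply_eq a
    refine ⟨Xinv f, lp.ext (funext fun j => ?_)⟩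
    have hXf : X (Xinv f) = f := DFunLike.congr_fun hXX f
    rw [hTΛ, hΛθ, ContinuousLinearMap.comp_apply, hXf, hf]
  · intro hsurj
    have hker : TΛ.ker = ⊥ := by
      refine (Submodule.eq_bot_iff _).2 fun f hf => ?_
      have hf' : TΛ f = 0 := hf
      have hΛf : ∀ j, Λ j f = 0 := fun j => by
        rw [← hTΛ, hf']
        rfl
      obtain ⟨A, B, hA, -, h⟩ := hΛ
      have hle : A * ‖f‖ ^ 2 ≤ 0 := by simpa [hΛf] using (h f).2.1
      simpa using le_antisymm (nonpos_of_mul_nonpos_right hle hA) (sq_nonneg ‖f‖)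
    let e := ContinuousLinearEquiv.ofBijective TΛ hker (LinearMap.range_eq_top.2 hsurj)
    obtain ⟨X, U, hXU⟩ := exists_polar_decomposition e
    let θ : ∀ j, H →L[ℂ] G j := fun j => (Λ j).comp (X.symm : H →L[ℂ] H)
    refine ⟨X, X.symm, θ, by ext; simp, by ext; simp,
      gONBasis_of_linearIsometryEquiv U θ fun j f => ?_, fun j => by ext; simp [θ]⟩
    have h : TΛ (X.symm f) = U f := by simpa [e] using hXU (X.symm f)
    rw [← h, hTΛ]
    rfl

end
end

section
/- Let Λ = (Λ_j)_{j∈J} be a g-frame of (H,(H_j)) and Θ = (θ_j) a dual g-frame of Λ. Then Θ is the canonical dual of Λ (θ_j = Λ_j ∘ S_Λ⁻¹ for all j) if and only if for every dual g-frame Γ = (Γ_j) of Λ and every f ∈ H one has Σ_j θ_j*(θ_j f) = Σ_j θ_j*(Γ_j f) (equality of the norm-convergent series in H; i.e. T_Θ* T_Θ = T_Θ* T_Γ). -/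
open scoped ComplexInnerProductSpace

noncomputable section

variable {J H : Type*} [NormedAddCommGroup H] [InnerProductSpace ℂ H] [CompleteSpace H]
  {G : J → Type*} [∀ j, NormedAddCommGroup (G j)] [∀ j, InnerProductSpace ℂ (G j)]
  [∀ j, CompleteSpace (G j)]

open ContinuousLinearMap

/-- The analysis operator of a g-frame, as a bounded operator into the `ℓ²`-direct sum. -/
theorem IsGFrame.exists_analysis {Λ : ∀ j, H →L[ℂ] G j} (hΛ : IsGFrame Λ) :
    ∃ T : H →L[ℂ] lp G 2, ∀ f j, T f j = Λ j f := by
  obtain ⟨A, B, hA, hAB, h⟩ := hΛ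
  have hmem (f : H) : Memℓp (fun j => Λ j f) 2 := by
    rw [memℓp_gen_iff (by norm_num)]
    simpa using (h f).1
  let T : H →ₗ[ℂ] lp G 2 :=
    { toFun := fun f => ⟨fun j => Λ j f, hmem f⟩
      map_add' := fun f g => by ext j; exact map_add (Λ j) f g
      map_smul' := fun c f => by ext j; exact map_smul (Λ j) c f }
  refine ⟨T.mkContinuous (√B) fun f => ?_, fun f j => rfl⟩
  have hnorm : ‖T f‖ ^ 2 = ∑' j, ‖Λ j f‖ ^ 2 := by
    have := lp.norm_rpow_eq_tsum (p := 2) (by norm_num) (T f)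
    simpa [T] using this
  refine (sq_le_sq₀ (norm_nonneg _) (by positivity)).1 ?_
  rw [mul_pow, Real.sq_sqrt (hA.le.trans hAB), hnorm]
  exact (h f).2.2

/-- The synthesis operator is the adjoint of the analysis operator. -/
theorem hasSum_adjoint_analysis {Λ : ∀ j, H →L[ℂ] G j} {T : H →L[ℂ] lp G 2}
    (hT : ∀ f j, T f j = Λ j f) (g : lp G 2) :
    HasSum (fun j => adjoint (Λ j) (g j)) (adjoint T g) := by
  classical
  have h := (lp.hasSum_single (p := 2) (by norm_num) g).mapL (adjoint T)
  refine h.congr_fun fun j => ?_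
  refine ext_inner_right ℂ fun f => ?_
  rw [adjoint_inner_left, adjoint_inner_left, lp.inner_single_left, hT]

/-- Composing a g-frame with an invertible operator gives a g-frame. -/
theorem IsGFrame.comp {Λ : ∀ j, H →L[ℂ] G j} (hΛ : IsGFrame Λ) {X Y : H →L[ℂ] H}
    (hYX : Y.comp X = ContinuousLinearMap.id ℂ H) :
    IsGFrame fun j => (Λ j).comp X := by
  obtain ⟨A, B, hA, hAB, h⟩ := hΛ
  have hB : 0 ≤ B := hA.le.trans hAB
  have hd : 0 < ‖Y‖ ^ 2 + 1 := by positivity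
  refine ⟨A / (‖Y‖ ^ 2 + 1), A / (‖Y‖ ^ 2 + 1) + B * ‖X‖ ^ 2, by positivity,
    le_add_of_nonneg_right (by positivity), fun f => ⟨(h (X f)).1, ?_, ?_⟩⟩
  · refine le_trans ?_ (h (X f)).2.1
    have hf : ‖f‖ ≤ ‖Y‖ * ‖X f‖ := by
      simpa [← ContinuousLinearMap.comp_apply, hYX] using Y.le_opNorm (X f)
    have hf2 : ‖f‖ ^ 2 ≤ (‖Y‖ ^ 2 + 1) * ‖X f‖ ^ 2 := by
      have := pow_le_pow_left₀ (norm_nonneg f) hf 2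
      nlinarith [sq_nonneg ‖X f‖]
    rw [div_mul_eq_mul_div, div_le_iff₀ hd]
    nlinarith [mul_le_mul_of_nonneg_left hf2 hA.le]
  · refine (h (X f)).2.2.trans ?_
    have hX := pow_le_pow_left₀ (norm_nonneg _) (X.le_opNorm f) 2
    have h1 : 0 ≤ A / (‖Y‖ ^ 2 + 1) * ‖f‖ ^ 2 := by positivity
    nlinarith [mul_le_mul_of_nonneg_left hX hB]

/-- A dual g-frame `Θ` of `Λ` is the canonical dual iff
`Σ_j θ_j*(θ_j f) = Σ_j θ_j*(Γ_j f)` for every dual g-frame `Γ` of `Λ` and every `f`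
(i.e. `T_Θ* T_Θ = T_Θ* T_Γ`). -/
theorem stmt_10 (Λ Θ : ∀ j, H →L[ℂ] G j) (hΛ : IsGFrame Λ)
    (S Sinv : H →L[ℂ] H) (hS : IsGFrameOp Λ S)
    (hS1 : S.comp Sinv = ContinuousLinearMap.id ℂ H)
    (hS2 : Sinv.comp S = ContinuousLinearMap.id ℂ H)
    (hΘ : IsDualGFrame Λ Θ) :
    (∀ j, Θ j = (Λ j).comp Sinv) ↔
    ∀ Γ : ∀ j, H →L[ℂ] G j, IsDualGFrame Λ Γ →
      ∀ f : H, ∑' j, ContinuousLinearMap.adjoint (Θ j) (Θ j f)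
        = ∑' j, ContinuousLinearMap.adjoint (Θ j) (Γ j f) := by
  have comp_eq {Γ₁ Γ₂ : ∀ j, H →L[ℂ] G j} {U V : H →L[ℂ] lp G 2} {R : H →L[ℂ] H}
      (hU : ∀ f j, U f j = Γ₁ j f) (hV : ∀ f j, V f j = Γ₂ j f)
      (h : ∀ f, HasSum (fun j => adjoint (Γ₁ j) (Γ₂ j f)) (R f)) : adjoint U ∘L V = R := by
    ext f
    have := hasSum_adjoint_analysis hU (V f)
    simp only [hV] at this
    exact this.unique (h f)
  have tsum_eq {Γ₁ Γ₂ : ∀ j, H →L[ℂ] G j} {U V : H →L[ℂ] lp G 2}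
      (hU : ∀ f j, U f j = Γ₁ j f) (hV : ∀ f j, V f j = Γ₂ j f) (f : H) :
      ∑' j, adjoint (Γ₁ j) (Γ₂ j f) = adjoint U (V f) := by
    have := hasSum_adjoint_analysis hU (V f)
    simp only [hV] at this
    exact this.tsum_eq
  obtain ⟨T, hT⟩ := hΛ.exists_analysis
  obtain ⟨U, hU⟩ := hΘ.1.exists_analysis
  have hTS : adjoint T ∘L T = S := comp_eq hT hT hS
  have hSadj : adjoint S = S := by rw [← hTS, adjoint_comp, adjoint_adjoint]
  have hSinv : adjoint Sinv = Sinv := by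
    have h : adjoint Sinv ∘L S = .id ℂ H := by
      rw [← hSadj, ← adjoint_comp, hS1, adjoint_id]
    rw [← comp_id (adjoint Sinv), ← hS1, ← comp_assoc, h, id_comp]
  have dual_comp {Γ : ∀ j, H →L[ℂ] G j} {V : H →L[ℂ] lp G 2} (hV : ∀ f j, V f j = Γ j f)
      (h : IsDualGFrame Λ Γ) : adjoint V ∘L T = .id ℂ H ∧ adjoint T ∘L V = .id ℂ H := by
    have h1 : adjoint V ∘L T = .id ℂ H := comp_eq hV hT h.2
    refine ⟨h1, ?_⟩
    simpa [adjoint_comp, adjoint_id] using congrArg adjoint h1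
  have hC (f : H) (j : J) : (T ∘L Sinv) f j = (Λ j ∘L Sinv) f := hT (Sinv f) j
  constructor
  · intro hcan Γ hΓ f
    obtain ⟨V, hV⟩ := hΓ.1.exists_analysis
    have hUT : U = T ∘L Sinv := by
      ext f j
      rw [hU, hC, hcan]
    rw [tsum_eq hU hU, tsum_eq hU hV]
    have hU' := (dual_comp hU hΘ).2
    have hV' := (dual_comp hV hΓ).2
    have e (W : H →L[ℂ] lp G 2) (hW : adjoint T ∘L W = .id ℂ H) :
        adjoint U (W f) = adjoint Sinv f := by
      rw [hUT, adjoint_comp]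
      exact congrArg (adjoint Sinv) (DFunLike.congr_fun hW f)
    rw [e U hU', e V hV']
  · intro h
    have hdual : IsDualGFrame Λ fun j => Λ j ∘L Sinv := by
      refine ⟨hΛ.comp hS1, fun f => ?_⟩
      have := (hS f).mapL Sinv
      rw [← comp_apply, hS2] at this
      simpa [adjoint_comp, hSinv] using this
    obtain ⟨hUT, hTU⟩ := dual_comp hU hΘ
    obtain ⟨-, hTC⟩ := dual_comp hC hdual
    have hUU : adjoint U ∘L (U - T ∘L Sinv) = 0 := by
      ext f
      have := h _ hdual f
      rw [tsum_eq hU hU, tsum_eq hU hC] at this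
      simpa [sub_eq_zero] using this
    have hTU' : adjoint T ∘L (U - T ∘L Sinv) = 0 := by
      rw [comp_sub, hTU, hTC, sub_self]
    have hD : U - T ∘L Sinv = 0 := by
      refine ContinuousLinearMap.ext fun f => ?_
      rw [zero_apply, ← inner_self_eq_zero (𝕜 := ℂ)]
      nth_rewrite 1 [sub_apply]
      rw [inner_sub_left, comp_apply, ← adjoint_inner_right, ← adjoint_inner_right,
        ← comp_apply (adjoint U), ← comp_apply (adjoint T), hUU, hTU']
      simp
    intro j
    ext f
    rw [← hU, ← hC, sub_eq_zero.mp hD]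

end
end

section
/- Let Λ = (Λ_j)_{j∈J} be a g-frame of (H,(H_j)) and Θ = (θ_j)_{j∈J} a family of bounded operators θ_j : H → H_j. Then Θ is a g-frame of (H,(H_j)) if and only if there exists a constant M > 0 such that for all f ∈ H, Σ_{j∈J} ‖Λ_j f − θ_j f‖² ≤ M · min( Σ_{j∈J} ‖Λ_j f‖² , Σ_{j∈J} ‖θ_j f‖² ), where the sums are taken in [0,∞]. -/
open scoped ComplexInnerProductSpace

noncomputable section

variable {J H : Type*} [NormedAddCommGroup H] [InnerProductSpace ℂ H] [CompleteSpace H]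
  {G : J → Type*} [∀ j, NormedAddCommGroup (G j)] [∀ j, InnerProductSpace ℂ (G j)]
  [∀ j, CompleteSpace (G j)]

open scoped ENNReal in
/-- The extended nonnegative sum of the squared norms of a family of vectors. -/
def ennrealSumSq {ι : Type*} {E : ι → Type*} [∀ i, NormedAddCommGroup (E i)]
    (x : ∀ i, E i) : ℝ≥0∞ :=
  ∑' i, ((‖x i‖₊ : ℝ≥0∞) ^ 2)

open scoped ENNReal in
theorem nnnorm_sq_eq_ofReal {E : Type*} [NormedAddCommGroup E] (x : E) :
    ((‖x‖₊ : ℝ≥0∞) ^ 2) = ENNReal.ofReal (‖x‖ ^ 2) := by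
  rw [ENNReal.ofReal_pow (norm_nonneg x), ofReal_norm]
  rfl

theorem ennrealSumSq_eq_ofReal {ι : Type*} {E : ι → Type*} [∀ i, NormedAddCommGroup (E i)]
    {x : ∀ i, E i} (hx : Summable (fun i => ‖x i‖ ^ 2)) :
    ennrealSumSq x = ENNReal.ofReal (∑' j, ‖x j‖ ^ 2) := by
  rw [ENNReal.ofReal_tsum_of_nonneg (fun j => sq_nonneg _) hx]
  exact tsum_congr fun j => nnnorm_sq_eq_ofReal (x j)

theorem summable_sq_of_ennrealSumSq_ne_top {ι : Type*} {E : ι → Type*} [∀ i, NormedAddCommGroup (E i)]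
    {x : ∀ i, E i} (hx : ennrealSumSq x ≠ ⊤) :
    Summable (fun j => ‖x j‖ ^ 2) := by
  have h := ENNReal.summable_toReal hx
  refine h.congr fun j => ?_
  simp

/-- Parallelogram bound for the extended sums of squares. -/
theorem ennrealSumSq_sub_le {ι : Type*} {E : ι → Type*} [∀ i, NormedAddCommGroup (E i)]
    (x y : ∀ i, E i) :
    ennrealSumSq (fun j => x j - y j) ≤ 2 * (ennrealSumSq x + ennrealSumSq y) := by
  unfold ennrealSumSq
  rw [← ENNReal.tsum_add, ← ENNReal.tsum_mul_left]
  refine ENNReal.tsum_le_tsum fun j => ?_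
  norm_cast
  rw [← NNReal.coe_le_coe]
  push_cast
  nlinarith [norm_sub_le (x j) (y j), norm_nonneg (x j - y j), sq_nonneg (‖x j‖ - ‖y j‖),
    norm_nonneg (x j), norm_nonneg (y j)]

/-- A g-frame is a family whose extended sums of squares satisfy the frame inequalities. -/
theorem isGFrame_iff_ennrealSumSq (Λ : ∀ j, H →L[ℂ] G j) :
    IsGFrame Λ ↔ ∃ A B : ℝ, 0 < A ∧ A ≤ B ∧ ∀ f : H,
      ENNReal.ofReal (A * ‖f‖ ^ 2) ≤ ennrealSumSq (fun j => Λ j f) ∧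
      ennrealSumSq (fun j => Λ j f) ≤ ENNReal.ofReal (B * ‖f‖ ^ 2) := by
  constructor
  · rintro ⟨A, B, hA, hAB, h⟩
    refine ⟨A, B, hA, hAB, fun f => ?_⟩
    obtain ⟨hs, hl, hu⟩ := h f
    rw [ennrealSumSq_eq_ofReal hs]
    exact ⟨ENNReal.ofReal_le_ofReal hl, ENNReal.ofReal_le_ofReal hu⟩
  · rintro ⟨A, B, hA, hAB, h⟩
    refine ⟨A, B, hA, hAB, fun f => ?_⟩
    obtain ⟨hl, hu⟩ := h f
    have hs := summable_sq_of_ennrealSumSq_ne_top (hu.trans_lt ENNReal.ofReal_lt_top).ne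
    rw [ennrealSumSq_eq_ofReal hs] at hl hu
    exact ⟨hs, (ENNReal.ofReal_le_ofReal_iff (tsum_nonneg fun j => sq_nonneg _)).1 hl,
      (ENNReal.ofReal_le_ofReal_iff
        (mul_nonneg (hA.le.trans hAB) (sq_nonneg _))).1 hu⟩

/-- Two g-frames have comparable sums of squares. -/
theorem IsGFrame.exists_ennrealSumSq_le {Λ Θ : ∀ j, H →L[ℂ] G j} (hΛ : IsGFrame Λ)
    (hΘ : IsGFrame Θ) : ∃ K : ℝ, 0 < K ∧ ∀ f : H,
      ennrealSumSq (fun j => Λ j f) ≤ ENNReal.ofReal K * ennrealSumSq (fun j => Θ j f) := by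
  obtain ⟨A, B, hA, hAB, h⟩ := (isGFrame_iff_ennrealSumSq Λ).1 hΛ
  obtain ⟨C, D, hC, -, h'⟩ := (isGFrame_iff_ennrealSumSq Θ).1 hΘ
  have hB : 0 < B := hA.trans_le hAB
  refine ⟨B / C, by positivity, fun f => (h f).2.trans ?_⟩
  calc ENNReal.ofReal (B * ‖f‖ ^ 2)
      = ENNReal.ofReal (B / C) * ENNReal.ofReal (C * ‖f‖ ^ 2) := by
        rw [← ENNReal.ofReal_mul (by positivity)]
        congr 1
        field_simp
    _ ≤ _ := by gcongr; exact (h' f).1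

/-- A family whose sums of squares are comparable with those of a g-frame is a g-frame. -/
theorem IsGFrame.of_ennrealSumSq_le {Λ Θ : ∀ j, H →L[ℂ] G j} (hΛ : IsGFrame Λ) {K : ℝ}
    (hK : 1 ≤ K)
    (h₁ : ∀ f : H,
      ennrealSumSq (fun j => Θ j f) ≤ ENNReal.ofReal K * ennrealSumSq (fun j => Λ j f))
    (h₂ : ∀ f : H,
      ennrealSumSq (fun j => Λ j f) ≤ ENNReal.ofReal K * ennrealSumSq (fun j => Θ j f)) :
    IsGFrame Θ := by
  obtain ⟨A, B, hA, hAB, h⟩ := (isGFrame_iff_ennrealSumSq Λ).1 hΛ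
  have hK0 : 0 < K := one_pos.trans_le hK
  have hB : 0 < B := hA.trans_le hAB
  refine (isGFrame_iff_ennrealSumSq Θ).2 ⟨A / K, K * B, by positivity, ?_, fun f => ⟨?_, ?_⟩⟩
  · exact (div_le_self hA.le hK).trans (hAB.trans (le_mul_of_one_le_left hB.le hK))
  · rw [div_mul_eq_mul_div, ENNReal.ofReal_div_of_pos hK0]
    exact ENNReal.div_le_of_le_mul' ((h f).1.trans (h₂ f))
  · rw [mul_assoc, ENNReal.ofReal_mul hK0.le]
    exact (h₁ f).trans (by gcongr; exact (h f).2)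

open scoped ENNReal in
/-- Given a g-frame `Λ`, a family `Θ` is a g-frame iff there is `M > 0`
with `Σ_j ‖Λ_j f − θ_j f‖² ≤ M · min(Σ_j ‖Λ_j f‖², Σ_j ‖θ_j f‖²)` (sums in `[0,∞]`). -/
theorem stmt_11 (Λ Θ : ∀ j, H →L[ℂ] G j) (hΛ : IsGFrame Λ) :
    IsGFrame Θ ↔
    ∃ M : ℝ, 0 < M ∧ ∀ f : H,
      (∑' j, ((‖Λ j f - Θ j f‖₊ : ℝ≥0∞) ^ 2)) ≤
        ENNReal.ofReal M *
          min (∑' j, ((‖Λ j f‖₊ : ℝ≥0∞) ^ 2)) (∑' j, ((‖Θ j f‖₊ : ℝ≥0∞) ^ 2)) := by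
  change IsGFrame Θ ↔ ∃ M : ℝ, 0 < M ∧ ∀ f : H,
    ennrealSumSq (fun j => Λ j f - Θ j f) ≤ ENNReal.ofReal M *
      min (ennrealSumSq (fun j => Λ j f)) (ennrealSumSq (fun j => Θ j f))
  constructor
  · intro hΘ
    obtain ⟨K, hK, h⟩ := hΛ.exists_ennrealSumSq_le hΘ
    obtain ⟨L, hL, h'⟩ := hΘ.exists_ennrealSumSq_le hΛ
    refine ⟨2 * (1 + K + L), by positivity, fun f => ?_⟩
    have hM : ENNReal.ofReal (2 * (1 + K + L)) =
        2 * (1 + ENNReal.ofReal K + ENNReal.ofReal L) := by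
      rw [ENNReal.ofReal_mul zero_le_two, ENNReal.ofReal_add (by positivity) hL.le,
        ENNReal.ofReal_add zero_le_one hK.le]
      simp
    refine (ennrealSumSq_sub_le _ _).trans ?_
    rw [hM, mul_assoc]
    gcongr
    obtain hmin | hmin := min_choice (ennrealSumSq fun j => Λ j f) (ennrealSumSq fun j => Θ j f)
    · rw [hmin, add_mul, add_mul, one_mul]
      exact add_le_add le_self_add (h' f)
    · rw [hmin, add_mul, add_mul, one_mul, add_comm]
      exact (add_le_add le_rfl (h f)).trans le_self_add
  · rintro ⟨M, hM, h⟩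
    have hK : ENNReal.ofReal (2 * (M + 1)) = 2 * (ENNReal.ofReal M + 1) := by
      rw [ENNReal.ofReal_mul zero_le_two, ENNReal.ofReal_add hM.le zero_le_one]
      simp
    refine hΛ.of_ennrealSumSq_le (K := 2 * (M + 1)) (by linarith) (fun f => ?_) fun f => ?_
    · have hsub := ennrealSumSq_sub_le (fun j => Λ j f) (fun j => Λ j f - Θ j f)
      simp only [sub_sub_cancel] at hsub
      refine hsub.trans ?_
      rw [hK, mul_assoc, add_mul, one_mul, add_comm]
      gcongr
      exact (h f).trans (by gcongr; exact min_le_left _ _)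
    · have hsub := ennrealSumSq_sub_le (fun j => Λ j f - Θ j f) (fun j => -Θ j f)
      have hneg : ennrealSumSq (fun j => -Θ j f) = ennrealSumSq (fun j => Θ j f) := by
        simp [ennrealSumSq]
      simp only [sub_neg_eq_add, sub_add_cancel, hneg] at hsub
      refine hsub.trans ?_
      rw [hK, mul_assoc, add_mul, one_mul]
      gcongr
      exact (h f).trans (by gcongr; exact min_le_right _ _)

end
end

section
/- Let Λ = (Λ_i)_{i∈J} and Θ = (θ_i)_{i∈J} be g-Bessel families of (H,(H_i)) with g-Bessel bounds B₁ and B₂ respectively, and suppose there exist real numbers m < 1 and n > −1 such that, for all f ∈ H, ‖f − Σ_i Λ_i*(θ_i f)‖ ≤ m‖f‖ + n‖Σ_i Λ_i*(θ_i f)‖ (the series Σ_i Λ_i*(θ_i f) converging in H). Then Θ is a g-frame; more precisely, Σ_i ‖θ_i f‖² ≥ (1/B₁)·((1−m)/(1+n))²·‖f‖² for all f ∈ H. -/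
open scoped ComplexInnerProductSpace

noncomputable section

variable {J H : Type*} [NormedAddCommGroup H] [InnerProductSpace ℂ H] [CompleteSpace H]
  {G : J → Type*} [∀ j, NormedAddCommGroup (G j)] [∀ j, InnerProductSpace ℂ (G j)]
  [∀ j, CompleteSpace (G j)]

/-- If `Λ` is g-Bessel with bound `B` and `v = Σ_i Λ_i* (g_i)`, then `‖v‖² ≤ B Σ_i ‖g_i‖²`. -/
theorem IsGBessel.norm_sq_le_of_hasSum {Λ : ∀ i, H →L[ℂ] G i} {B : ℝ} (hΛ : IsGBessel Λ B)
    {g : ∀ i, G i} (hg : Summable fun i => ‖g i‖ ^ 2) {v : H}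
    (hv : HasSum (fun i => ContinuousLinearMap.adjoint (Λ i) (g i)) v) :
    ‖v‖ ^ 2 ≤ B * ∑' i, ‖g i‖ ^ 2 := by
  obtain ⟨hB, hΛ⟩ := hΛ
  obtain ⟨hs, hle⟩ := hΛ v
  have hinner : HasSum (fun i => (inner ℂ (Λ i v) (g i)).re) (‖v‖ ^ 2) := by
    have h := Complex.reCLM.hasSum ((innerSL ℂ v).hasSum hv)
    have hre : (inner ℂ v v).re = ‖v‖ ^ 2 := inner_self_eq_norm_sq (𝕜 := ℂ) v
    simpa [-inner_self_eq_norm_sq_to_K, Function.comp_def,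
      ContinuousLinearMap.adjoint_inner_right, hre] using h
  have hterm : ∀ i, (inner ℂ (Λ i v) (g i)).re ≤
      B / 2 * ‖g i‖ ^ 2 + 1 / (2 * B) * ‖Λ i v‖ ^ 2 := fun i => by
    have h₁ : (inner ℂ (Λ i v) (g i)).re ≤ ‖Λ i v‖ * ‖g i‖ := re_inner_le_norm (𝕜 := ℂ) _ _
    have h₂ : B / 2 * ‖g i‖ ^ 2 + 1 / (2 * B) * ‖Λ i v‖ ^ 2 - ‖Λ i v‖ * ‖g i‖ =
        1 / (2 * B) * (B * ‖g i‖ - ‖Λ i v‖) ^ 2 := by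
      field_simp
      ring
    have h₃ : 0 ≤ 1 / (2 * B) * (B * ‖g i‖ - ‖Λ i v‖) ^ 2 := by positivity
    linarith
  have hsum := hasSum_le hterm hinner
    ((hg.hasSum.mul_left (B / 2)).add (hs.hasSum.mul_left (1 / (2 * B))))
  have hhalf : 1 / (2 * B) * ∑' i, ‖Λ i v‖ ^ 2 ≤ ‖v‖ ^ 2 / 2 := by
    calc 1 / (2 * B) * ∑' i, ‖Λ i v‖ ^ 2 ≤ 1 / (2 * B) * (B * ‖v‖ ^ 2) := by gcongr
      _ = ‖v‖ ^ 2 / 2 := by field_simp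
  linarith

/-- If `Λ, Θ` are g-Bessel with bounds `B₁, B₂`, `m < 1`, `n > −1` and
`‖f − Σ_i Λ_i*(θ_i f)‖ ≤ m‖f‖ + n‖Σ_i Λ_i*(θ_i f)‖` for all `f`, then `Θ` is a g-frame
with lower bound `(1/B₁)((1−m)/(1+n))²`. -/
theorem stmt_13 (Λ Θ : ∀ i, H →L[ℂ] G i) (B₁ B₂ : ℝ)
    (hΛ : IsGBessel Λ B₁) (hΘ : IsGBessel Θ B₂)
    (m n : ℝ) (hm : m < 1) (hn : -1 < n)
    (V : H → H)
    (hV : ∀ f : H, HasSum (fun i => ContinuousLinearMap.adjoint (Λ i) (Θ i f)) (V f))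
    (hineq : ∀ f : H, ‖f - V f‖ ≤ m * ‖f‖ + n * ‖V f‖) :
    IsGFrame Θ ∧
    ∀ f : H, 1 / B₁ * ((1 - m) / (1 + n)) ^ 2 * ‖f‖ ^ 2 ≤ ∑' i, ‖Θ i f‖ ^ 2 := by
  have hn' : 0 < 1 + n := by linarith
  have hm' : 0 < 1 - m := by linarith
  have hB₁ := hΛ.1
  have lower : ∀ f : H,
      1 / B₁ * ((1 - m) / (1 + n)) ^ 2 * ‖f‖ ^ 2 ≤ ∑' i, ‖Θ i f‖ ^ 2 := fun f => by
    have hVf : (1 - m) / (1 + n) * ‖f‖ ≤ ‖V f‖ := by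
      rw [div_mul_eq_mul_div, div_le_iff₀ hn']
      linarith [hineq f, norm_sub_norm_le f (V f)]
    calc 1 / B₁ * ((1 - m) / (1 + n)) ^ 2 * ‖f‖ ^ 2
        = 1 / B₁ * ((1 - m) / (1 + n) * ‖f‖) ^ 2 := by ring
      _ ≤ 1 / B₁ * ‖V f‖ ^ 2 := by gcongr
      _ ≤ 1 / B₁ * (B₁ * ∑' i, ‖Θ i f‖ ^ 2) := by
        gcongr
        exact hΛ.norm_sq_le_of_hasSum (hΘ.2 f).1 (hV f)
      _ = ∑' i, ‖Θ i f‖ ^ 2 := by field_simp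
  refine ⟨⟨1 / B₁ * ((1 - m) / (1 + n)) ^ 2, max (1 / B₁ * ((1 - m) / (1 + n)) ^ 2) B₂,
    by positivity, le_max_left _ _, fun f => ⟨(hΘ.2 f).1, lower f, (hΘ.2 f).2.trans ?_⟩⟩, lower⟩
  gcongr
  exact le_max_right _ _

end
end

section
/- Let Λ = (Λ_i)_{i∈J} and Θ = (θ_i)_{i∈J} be g-Bessel families of (H,(H_i)) with g-Bessel bounds B₁ and B₂ respectively, and suppose there exists 0 ≤ m < 1 such that ‖f − Σ_i Λ_i*(θ_i f)‖ ≤ m‖f‖ for all f ∈ H. Then both Λ and Θ are g-frames; more precisely, Σ_i ‖θ_i f‖² ≥ (1/B₁)(1−m)²‖f‖² and Σ_i ‖Λ_i f‖² ≥ (1/B₂)(1−m)²‖f‖² for all f ∈ H. -/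
open scoped ComplexInnerProductSpace

noncomputable section

variable {J H : Type*} [NormedAddCommGroup H] [InnerProductSpace ℂ H] [CompleteSpace H]
  {G : J → Type*} [∀ j, NormedAddCommGroup (G j)] [∀ j, InnerProductSpace ℂ (G j)]
  [∀ j, CompleteSpace (G j)]

/-- Cauchy–Schwarz for the mixed frame operator `V f = Σ_i Λ_i* (Θ_i f)`. -/
theorem re_inner_le_sqrt_tsum_mul_tsum (Λ Θ : ∀ i, H →L[ℂ] G i) {f v : H}
    (hΛ : Summable fun i => ‖Λ i f‖ ^ 2) (hΘ : Summable fun i => ‖Θ i f‖ ^ 2)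
    (hv : HasSum (fun i => ContinuousLinearMap.adjoint (Λ i) (Θ i f)) v) :
    RCLike.re (inner ℂ f v) ≤ √((∑' i, ‖Λ i f‖ ^ 2) * ∑' i, ‖Θ i f‖ ^ 2) := by
  have hsum : HasSum (fun i => RCLike.re (inner ℂ (Λ i f) (Θ i f))) (RCLike.re (inner ℂ f v)) := by
    have h := RCLike.hasSum_re ℂ (hv.mapL (innerSL ℂ f))
    simpa [ContinuousLinearMap.adjoint_inner_right] using h
  refine hasSum_le_of_sum_le hsum fun s => ?_
  calc ∑ i ∈ s, RCLike.re (inner ℂ (Λ i f) (Θ i f))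
      ≤ ∑ i ∈ s, ‖Λ i f‖ * ‖Θ i f‖ := Finset.sum_le_sum fun i _ => re_inner_le_norm _ _
    _ ≤ √((∑' i, ‖Λ i f‖ ^ 2) * ∑' i, ‖Θ i f‖ ^ 2) := by
      refine Real.le_sqrt_of_sq_le ((Finset.sum_mul_sq_le_sq_mul_sq s _ _).trans ?_)
      exact mul_le_mul (hΛ.sum_le_tsum s fun _ _ => sq_nonneg _)
        (hΘ.sum_le_tsum s fun _ _ => sq_nonneg _)
        (Finset.sum_nonneg fun _ _ => sq_nonneg _) (tsum_nonneg fun _ => sq_nonneg _)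

theorem one_sub_mul_norm_sq_le_re_inner {E : Type*} [NormedAddCommGroup E]
    [InnerProductSpace ℂ E] {f v : E} {m : ℝ} (h : ‖f - v‖ ≤ m * ‖f‖) :
    (1 - m) * ‖f‖ ^ 2 ≤ RCLike.re (inner ℂ f v) := by
  have h1 : RCLike.re (inner ℂ f (f - v)) ≤ ‖f‖ * ‖f - v‖ := re_inner_le_norm _ _
  have h2 := mul_le_mul_of_nonneg_left h (norm_nonneg f)
  rw [inner_sub_right, map_sub, inner_self_eq_norm_sq] at h1
  linarith

theorem div_mul_le_of_sq_mul_le {B c x X Y : ℝ} (hB : 0 < B) (hx : 0 ≤ x) (hY : 0 ≤ Y)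
    (hX : X ≤ B * x) (h : (c * x) ^ 2 ≤ X * Y) : 1 / B * c ^ 2 * x ≤ Y := by
  rcases hx.eq_or_lt with rfl | hx
  · simpa using hY
  · have h1 : (c ^ 2 * x) * x ≤ (B * Y) * x := by
      nlinarith [mul_le_mul_of_nonneg_right hX hY]
    have h2 := le_of_mul_le_mul_right h1 hx
    rw [mul_assoc, one_div_mul_eq_div, div_le_iff₀ hB]
    linarith

theorem IsGBessel.isGFrame {ι E : Type*} [NormedAddCommGroup E] [InnerProductSpace ℂ E]
    {F : ι → Type*} [∀ j, NormedAddCommGroup (F j)] [∀ j, InnerProductSpace ℂ (F j)]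
    {Λ : ∀ j, E →L[ℂ] F j} {A B : ℝ} (hΛ : IsGBessel Λ B) (hA : 0 < A)
    (h : ∀ f : E, A * ‖f‖ ^ 2 ≤ ∑' j, ‖Λ j f‖ ^ 2) : IsGFrame Λ :=
  ⟨A, max A B, hA, le_max_left _ _, fun f => ⟨(hΛ.2 f).1, h f, (hΛ.2 f).2.trans <| by
    gcongr
    exact le_max_right _ _⟩⟩

/-- If `Λ, Θ` are g-Bessel with bounds `B₁, B₂`, `0 ≤ m < 1` and
`‖f − Σ_i Λ_i*(θ_i f)‖ ≤ m‖f‖` for all `f`, then both `Λ` and `Θ` are g-frames,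
with lower bounds `(1/B₂)(1−m)²` and `(1/B₁)(1−m)²` respectively. -/
theorem stmt_14 (Λ Θ : ∀ i, H →L[ℂ] G i) (B₁ B₂ : ℝ)
    (hΛ : IsGBessel Λ B₁) (hΘ : IsGBessel Θ B₂)
    (m : ℝ) (hm0 : 0 ≤ m) (hm1 : m < 1)
    (V : H → H)
    (hV : ∀ f : H, HasSum (fun i => ContinuousLinearMap.adjoint (Λ i) (Θ i f)) (V f))
    (hineq : ∀ f : H, ‖f - V f‖ ≤ m * ‖f‖) :
    (IsGFrame Λ ∧ IsGFrame Θ) ∧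
    (∀ f : H, 1 / B₁ * (1 - m) ^ 2 * ‖f‖ ^ 2 ≤ ∑' i, ‖Θ i f‖ ^ 2) ∧
    ∀ f : H, 1 / B₂ * (1 - m) ^ 2 * ‖f‖ ^ 2 ≤ ∑' i, ‖Λ i f‖ ^ 2 := by
  have key (f : H) :
      ((1 - m) * ‖f‖ ^ 2) ^ 2 ≤ (∑' i, ‖Λ i f‖ ^ 2) * ∑' i, ‖Θ i f‖ ^ 2 := by
    have h := (one_sub_mul_norm_sq_le_re_inner (hineq f)).trans
      (re_inner_le_sqrt_tsum_mul_tsum Λ Θ (hΛ.2 f).1 (hΘ.2 f).1 (hV f))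
    have hm : 0 ≤ 1 - m := by linarith
    exact (pow_le_pow_left₀ (by positivity) h 2).trans_eq <| Real.sq_sqrt <|
      mul_nonneg (tsum_nonneg fun _ => sq_nonneg _) (tsum_nonneg fun _ => sq_nonneg _)
  have lowerΘ (f : H) : 1 / B₁ * (1 - m) ^ 2 * ‖f‖ ^ 2 ≤ ∑' i, ‖Θ i f‖ ^ 2 :=
    div_mul_le_of_sq_mul_le hΛ.1 (sq_nonneg _) (tsum_nonneg fun _ => sq_nonneg _)
      (hΛ.2 f).2 (key f)
  have lowerΛ (f : H) : 1 / B₂ * (1 - m) ^ 2 * ‖f‖ ^ 2 ≤ ∑' i, ‖Λ i f‖ ^ 2 :=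
    div_mul_le_of_sq_mul_le hΘ.1 (sq_nonneg _) (tsum_nonneg fun _ => sq_nonneg _)
      (hΘ.2 f).2 ((key f).trans_eq (mul_comm _ _))
  have hpos {B : ℝ} (hB : 0 < B) : 0 < 1 / B * (1 - m) ^ 2 :=
    mul_pos (one_div_pos.mpr hB) (pow_pos (sub_pos.mpr hm1) 2)
  exact ⟨⟨hΛ.isGFrame (hpos hΘ.1) lowerΛ, hΘ.isGFrame (hpos hΛ.1) lowerΘ⟩, lowerΘ, lowerΛ⟩

end
end
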